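/- arXiv:2401.06493 — 10 statements merged into one kernel-verified Lean document; each statement's English description precedes it below -/
import Mathlib

section
/- Let V be a finite set with n+1 elements, let c : ℕ×ℕ → ℚ be a coefficient function, let φ : 2^V → {0,1} be a Boolean function, let x ∈ V, and let p_y ∈ [0,1] for y ∈ V be probability values. Then Escore_c(φ, x) = p_x · Σ_{k=0}^{n} Σ_{ℓ=0}^{k} c(k+1, ℓ) · ( ENV_{k,ℓ}(φ_{+x}) − ENV_{k,ℓ}(φ_{−x}) ), where the quantities ENV_{k,ℓ} are computed over the variable set V∖{x} with the probability values p_y for y ∈ V∖{x}. -/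
open Finset

variable {α : Type*} [DecidableEq α]

/-- `PiP p W Z` is the probability `Π_W(Z)` of drawing `Z ⊆ W` when each `x ∈ W`
is chosen independently with probability `p x`. -/
noncomputable def PiP (p : α → ℝ) (W Z : Finset α) : ℝ :=
  (∏ x ∈ Z, p x) * (∏ x ∈ W \ Z, (1 - p x))

/-- The Shapley-like score with coefficient function `c` of `x` in `W` w.r.t. `φ`. -/
noncomputable def score (c : ℕ × ℕ → ℚ) (φ : Finset α → ℝ) (W : Finset α) (x : α) : ℝ :=
  ∑ E ∈ (W.erase x).powerset, (c (W.card, E.card) : ℝ) * (φ (insert x E) - φ E)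

/-- The expected Shapley-like score of `x` for `φ`, over variable set `V`. -/
noncomputable def Escore (c : ℕ × ℕ → ℚ) (p : α → ℝ) (V : Finset α) (φ : Finset α → ℝ)
    (x : α) : ℝ :=
  ∑ Z ∈ V.powerset.filter (fun Z => x ∈ Z), PiP p V Z * score c φ Z x

/-- The expected value `EV(φ)` over variable set `V`. -/
noncomputable def EV (p : α → ℝ) (V : Finset α) (φ : Finset α → ℝ) : ℝ :=
  ∑ Z ∈ V.powerset, PiP p V Z * φ Z

/-- The expected value of fixed size `k`. -/
noncomputable def EVk (p : α → ℝ) (V : Finset α) (φ : Finset α → ℝ) (k : ℕ) : ℝ :=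
  ∑ Z ∈ V.powerset.filter (fun Z => Z.card = k), PiP p V Z * φ Z

/-- The expected nested value `ENV(φ)`. -/
noncomputable def ENV (p : α → ℝ) (V : Finset α) (φ : Finset α → ℝ) : ℝ :=
  ∑ Z ∈ V.powerset, PiP p V Z * ∑ E ∈ Z.powerset, φ E

/-- The expected nested value of fixed sizes `ENV_{k,ℓ}(φ)`. -/
noncomputable def ENVkl (p : α → ℝ) (V : Finset α) (φ : Finset α → ℝ) (k ℓ : ℕ) : ℝ :=
  ∑ Z ∈ V.powerset.filter (fun Z => Z.card = k), PiP p V Z *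
    ∑ E ∈ Z.powerset.filter (fun E => E.card = ℓ), φ E

/-- Expected score in terms of expected nested values of fixed sizes
(Equation (1) of the paper). -/
theorem escore_eq_sum_envkl (c : ℕ × ℕ → ℚ) (p : α → ℝ) (V : Finset α) (n : ℕ)
    (hV : V.card = n + 1) (φ : Finset α → ℝ) (hφ : ∀ E, φ E = 0 ∨ φ E = 1)
    (x : α) (hx : x ∈ V) (hp : ∀ y ∈ V, 0 ≤ p y ∧ p y ≤ 1) :
    Escore c p V φ x =
      p x * ∑ k ∈ Finset.range (n + 1), ∑ ℓ ∈ Finset.range (k + 1),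
        (c (k + 1, ℓ) : ℝ) *
          (ENVkl p (V.erase x) (fun E => φ (insert x E)) k ℓ
            - ENVkl p (V.erase x) φ k ℓ) := by
  have hS : ∀ Z ∈ (V.erase x).powerset, PiP p V (insert x Z) * score c φ (insert x Z) x =
      p x * ∑ ℓ ∈ Finset.range (Z.card + 1), (c (Z.card + 1, ℓ) : ℝ) *
        (PiP p (V.erase x) Z * ∑ E ∈ Z.powerset.filter (fun E => E.card = ℓ),
          (φ (insert x E) - φ E)) := by
    intro Z hZ
    have hxZ : x ∉ Z := fun h => by
      have := Finset.mem_powerset.1 hZ h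
      simp at this
    have h1 : PiP p V (insert x Z) = p x * PiP p (V.erase x) Z := by
      unfold PiP
      rw [Finset.prod_insert hxZ, mul_assoc]
      congr 3
      ext y
      simp only [Finset.mem_sdiff, Finset.mem_insert, Finset.mem_erase]
      tauto
    have h2 : score c φ (insert x Z) x = ∑ ℓ ∈ Finset.range (Z.card + 1),
        (c (Z.card + 1, ℓ) : ℝ) * ∑ E ∈ Z.powerset.filter (fun E => E.card = ℓ),
          (φ (insert x E) - φ E) := by
      unfold score
      rw [Finset.erase_insert hxZ, Finset.card_insert_of_notMem hxZ]
      rw [← Finset.sum_fiberwise_of_maps_to (s := Z.powerset) (t := Finset.range (Z.card + 1))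
        (g := Finset.card)]
      · refine Finset.sum_congr rfl fun l _ => ?_
        rw [Finset.mul_sum]
        refine Finset.sum_congr rfl fun E hE => ?_
        rw [(Finset.mem_filter.1 hE).2]
      · intro E hE
        exact Finset.mem_range.2
          (Nat.lt_succ_of_le (Finset.card_le_card (Finset.mem_powerset.1 hE)))
    rw [h1, h2, mul_assoc, Finset.mul_sum]
    congr 1
    refine Finset.sum_congr rfl fun l _ => ?_
    ring
  have hE : Escore c p V φ x = ∑ Z ∈ (V.erase x).powerset,
      PiP p V (insert x Z) * score c φ (insert x Z) x := by
    unfold Escore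
    symm
    refine Finset.sum_bij' (fun Z _ => insert x Z) (fun Z _ => Z.erase x) ?_ ?_ ?_ ?_ ?_
    · intro Z hZ
      rw [Finset.mem_powerset] at hZ
      simp only [Finset.mem_filter, Finset.mem_powerset, Finset.mem_insert_self, and_true]
      exact Finset.insert_subset hx (hZ.trans (Finset.erase_subset _ _))
    · intro Z hZ
      simp only [Finset.mem_filter, Finset.mem_powerset] at hZ ⊢
      exact Finset.erase_subset_erase _ hZ.1
    · intro Z hZ
      refine Finset.erase_insert fun h => ?_
      have := Finset.mem_powerset.1 hZ h
      simp at this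
    · intro Z hZ
      exact Finset.insert_erase (Finset.mem_filter.1 hZ).2
    · intro Z hZ
      rfl
  rw [hE, Finset.sum_congr rfl hS, ← Finset.mul_sum]
  congr 1
  rw [← Finset.sum_fiberwise_of_maps_to (s := (V.erase x).powerset) (t := Finset.range (n + 1))
        (g := Finset.card)]
  · refine Finset.sum_congr rfl fun k _ => ?_
    unfold ENVkl
    simp_rw [← Finset.sum_sub_distrib, ← mul_sub, ← Finset.sum_sub_distrib, Finset.mul_sum (Finset.filter (fun Z => Finset.card Z = k) _)]
    rw [Finset.sum_comm]
    refine Finset.sum_congr rfl fun Z hZ => ?_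
    rw [(Finset.mem_filter.1 hZ).2]
  · intro Z hZ
    have := Finset.card_le_card (Finset.mem_powerset.1 hZ)
    rw [Finset.card_erase_of_mem hx, hV] at this
    exact Finset.mem_range.2 (by omega)
end

section
/- Let V be a finite set with n elements, φ : 2^V → {0,1} a Boolean function, p_x ∈ [0,1] probability values for x ∈ V, and z > 0 a rational number. For x ∈ V set c^z_x = 2z·p_x + 1 − p_x and p^z_x = z·p_x / c^z_x, and let C_z = ∏_{x∈V} c^z_x. Then each p^z_x lies in [0,1], and for every ℓ ∈ {0,…,n}, letting EV^z_ℓ(φ) denote the expected value of fixed size ℓ of φ computed with the probabilities p^z_x, we have C_z · EV^z_ℓ(φ) = Σ_{j=0}^{n} z^j · ENV_{j,ℓ}(φ), where ENV_{j,ℓ}(φ) is computed with the original probabilities p_x. -/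
open Finset

variable {α : Type*} [DecidableEq α]

/-- Key identity for one set `E`. -/
theorem aux_key (p : α → ℝ) (V E : Finset α) (hE : E ⊆ V) (z : ℝ)
    (hc : ∀ x ∈ V, 2 * z * p x + 1 - p x ≠ 0) :
    (∏ x ∈ V, (2 * z * p x + 1 - p x)) *
      PiP (fun x => z * p x / (2 * z * p x + 1 - p x)) V E =
    ∑ Z ∈ V.powerset.filter (fun Z => E ⊆ Z), z ^ Z.card * PiP p V Z := by
  have h1 : (∏ x ∈ V, (2 * z * p x + 1 - p x)) *
      PiP (fun x => z * p x / (2 * z * p x + 1 - p x)) V E =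
      (∏ x ∈ E, z * p x) * ∏ x ∈ V \ E, (z * p x + (1 - p x)) := by
    unfold PiP
    rw [← Finset.prod_sdiff hE]
    have a1 : (∏ x ∈ E, z * p x) = (∏ x ∈ E, (2 * z * p x + 1 - p x)) *
        ∏ x ∈ E, (z * p x / (2 * z * p x + 1 - p x)) := by
      rw [← Finset.prod_mul_distrib]
      refine Finset.prod_congr rfl fun x hx => ?_
      rw [mul_div_cancel₀ _ (hc x (hE hx))]
    have a2 : (∏ x ∈ V \ E, (z * p x + (1 - p x))) =
        (∏ x ∈ V \ E, (2 * z * p x + 1 - p x)) *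
        ∏ x ∈ V \ E, (1 - z * p x / (2 * z * p x + 1 - p x)) := by
      rw [← Finset.prod_mul_distrib]
      refine Finset.prod_congr rfl fun x hx => ?_
      rw [mul_sub, mul_div_cancel₀ _ (hc x (Finset.mem_sdiff.1 hx).1)]
      ring
    rw [a1, a2]
    ring
  rw [h1, Finset.prod_add, Finset.mul_sum]
  refine Finset.sum_bij' (fun A _ => E ∪ A) (fun Z _ => Z \ E) ?_ ?_ ?_ ?_ ?_
  · intro A hA
    simp only [mem_powerset, mem_filter] at *
    exact ⟨union_subset hE (hA.trans sdiff_subset), subset_union_left⟩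
  · intro Z hZ
    simp only [mem_powerset, mem_filter] at *
    exact sdiff_subset_sdiff hZ.1 le_rfl
  · intro A hA
    simp only [mem_powerset] at hA
    ext x
    have := @hA x
    simp only [mem_sdiff, mem_union] at *
    tauto
  · intro Z hZ
    simp only [mem_filter] at hZ
    exact union_sdiff_of_subset hZ.2
  · intro A hA
    simp only [mem_powerset] at hA
    have hd : Disjoint E A := (disjoint_sdiff (s := E) (t := V)).mono_right hA
    unfold PiP
    rw [sdiff_sdiff_left, ← mul_assoc, ← Finset.prod_union hd, Finset.prod_mul_distrib,
      Finset.prod_const, mul_assoc]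
    rfl

/-- Polynomial interpolation identity reducing `ENV_{j,ℓ}` to expected values of fixed size
(Equation (3) of the paper). -/
theorem evk_modified_prob_eq_sum_envkl (p : α → ℝ) (V : Finset α) (n : ℕ)
    (hV : V.card = n) (φ : Finset α → ℝ) (hφ : ∀ E, φ E = 0 ∨ φ E = 1)
    (hp : ∀ x ∈ V, 0 ≤ p x ∧ p x ≤ 1) (z : ℝ) (hz : 0 < z) :
    (∀ x ∈ V, 0 ≤ z * p x / (2 * z * p x + 1 - p x)
        ∧ z * p x / (2 * z * p x + 1 - p x) ≤ 1) ∧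
    ∀ ℓ ∈ Finset.range (n + 1),
      (∏ x ∈ V, (2 * z * p x + 1 - p x)) *
          EVk (fun x => z * p x / (2 * z * p x + 1 - p x)) V φ ℓ =
        ∑ j ∈ Finset.range (n + 1), z ^ j * ENVkl p V φ j ℓ := by
  have hpos : ∀ x ∈ V, 0 < 2 * z * p x + 1 - p x := by
    intro x hx
    obtain ⟨h0, h1⟩ := hp x hx
    rcases h0.eq_or_lt with h | h
    · rw [← h]; norm_num
    · have := mul_pos hz h
      linarith
  refine ⟨fun x hx => ?_, fun ℓ _ => ?_⟩
  · obtain ⟨h0, h1⟩ := hp x hx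
    have := mul_nonneg hz.le h0
    refine ⟨div_nonneg this (hpos x hx).le, ?_⟩
    rw [div_le_one (hpos x hx)]
    linarith
  · have hR : ∑ j ∈ Finset.range (n + 1), z ^ j * ENVkl p V φ j ℓ =
        ∑ Z ∈ V.powerset, z ^ Z.card * (PiP p V Z *
          ∑ E ∈ Z.powerset.filter (fun E => E.card = ℓ), φ E) := by
      rw [← Finset.sum_fiberwise_of_maps_to (s := V.powerset) (t := Finset.range (n + 1))
        (g := Finset.card)]
      · refine Finset.sum_congr rfl fun j _ => ?_
        unfold ENVkl
        rw [Finset.mul_sum]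
        refine Finset.sum_congr rfl fun Z hZ => ?_
        rw [(Finset.mem_filter.1 hZ).2]
      · intro Z hZ
        have := Finset.card_le_card (Finset.mem_powerset.1 hZ)
        rw [Finset.mem_range]
        omega
    rw [hR]
    unfold EVk
    rw [Finset.mul_sum]
    have hL : ∀ E ∈ V.powerset.filter (fun Z => Z.card = ℓ),
        (∏ x ∈ V, (2 * z * p x + 1 - p x)) *
          (PiP (fun x => z * p x / (2 * z * p x + 1 - p x)) V E * φ E) =
        ∑ Z ∈ V.powerset.filter (fun Z => E ⊆ Z), z ^ Z.card * (PiP p V Z * φ E) := by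
      intro E hE
      rw [← mul_assoc, aux_key p V E (Finset.mem_powerset.1 (Finset.mem_filter.1 hE).1) z
        (fun x hx => (hpos x hx).ne'), Finset.sum_mul]
      exact Finset.sum_congr rfl fun Z _ => by ring
    rw [Finset.sum_congr rfl hL]
    simp only [Finset.mul_sum]
    refine Finset.sum_comm' ?_
    intro E Z
    simp only [mem_filter, mem_powerset]
    constructor
    · rintro ⟨⟨a, b⟩, c, d⟩
      exact ⟨⟨d, b⟩, c⟩
    · rintro ⟨⟨d, b⟩, c⟩
      exact ⟨⟨d.trans c, b⟩, c, d⟩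
end

section
/- Let V be a finite set with n elements, φ : 2^V → {0,1} a Boolean function, p_x ∈ [0,1] probability values for x ∈ V, and z > 0 a rational number. For x ∈ V set c^z_x = 1 − p_x + z·p_x and p^z_x = z·p_x / c^z_x, and let C_z = ∏_{x∈V} c^z_x. Then each p^z_x lies in [0,1], and letting EV^z(φ) denote the expected value of φ computed with the probabilities p^z_x, we have C_z · EV^z(φ) = Σ_{j=0}^{n} z^j · EV_j(φ), where EV_j(φ) is the expected value of fixed size j computed with the original probabilities p_x. -/
open Finset

variable {α : Type*} [DecidableEq α]

/-- Polynomial interpolation identity reducing expected values of fixed size to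
expected values. -/
theorem ev_modified_prob_eq_sum_evk (p : α → ℝ) (V : Finset α) (n : ℕ)
    (hV : V.card = n) (φ : Finset α → ℝ) (hφ : ∀ E, φ E = 0 ∨ φ E = 1)
    (hp : ∀ x ∈ V, 0 ≤ p x ∧ p x ≤ 1) (z : ℝ) (hz : 0 < z) :
    (∀ x ∈ V, 0 ≤ z * p x / (1 - p x + z * p x)
        ∧ z * p x / (1 - p x + z * p x) ≤ 1) ∧
    (∏ x ∈ V, (1 - p x + z * p x)) *
        EV (fun x => z * p x / (1 - p x + z * p x)) V φ =
      ∑ j ∈ Finset.range (n + 1), z ^ j * EVk p V φ j := by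
  have hc : ∀ x ∈ V, 0 < 1 - p x + z * p x := by
    intro x hx
    obtain ⟨h0, h1⟩ := hp x hx
    rcases h0.eq_or_lt with h | h
    · rw [← h]; norm_num
    · have := mul_pos hz h
      linarith
  refine ⟨fun x hx => ⟨div_nonneg (mul_nonneg hz.le (hp x hx).1) (hc x hx).le, ?_⟩, ?_⟩
  · rw [div_le_one (hc x hx)]
    linarith [(hp x hx).2]
  have key : ∀ Z ∈ V.powerset, (∏ x ∈ V, (1 - p x + z * p x)) *
      PiP (fun x => z * p x / (1 - p x + z * p x)) V Z = z ^ Z.card * PiP p V Z := by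
    intro Z hZ
    have hZV := Finset.mem_powerset.mp hZ
    unfold PiP
    rw [← Finset.prod_sdiff hZV]
    have e1 : (∏ x ∈ Z, (1 - p x + z * p x)) * (∏ x ∈ Z, z * p x / (1 - p x + z * p x))
        = z ^ Z.card * ∏ x ∈ Z, p x := by
      rw [← Finset.prod_mul_distrib, ← Finset.prod_const, ← Finset.prod_mul_distrib]
      refine Finset.prod_congr rfl fun x hx => ?_
      exact mul_div_cancel₀ _ (hc x (hZV hx)).ne'
    have e2 : (∏ x ∈ V \ Z, (1 - p x + z * p x)) *
        (∏ x ∈ V \ Z, (1 - z * p x / (1 - p x + z * p x))) = ∏ x ∈ V \ Z, (1 - p x) := by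
      rw [← Finset.prod_mul_distrib]
      refine Finset.prod_congr rfl fun x hx => ?_
      have := (hc x (Finset.sdiff_subset hx)).ne'
      rw [mul_sub, mul_div_cancel₀ _ this]
      ring
    rw [← e2, ← mul_assoc (z ^ Z.card), ← e1]
    beta_reduce
    generalize (∏ x ∈ Z, z * p x / (1 - p x + z * p x)) = A
    generalize (∏ x ∈ V \ Z, (1 - z * p x / (1 - p x + z * p x))) = B
    ring
  have hmaps : ∀ Z ∈ V.powerset, Z.card ∈ Finset.range (n + 1) := by
    intro Z hZ
    have := Finset.card_le_card (Finset.mem_powerset.mp hZ)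
    rw [Finset.mem_range]
    omega
  unfold EV EVk
  rw [Finset.mul_sum, ← Finset.sum_fiberwise_of_maps_to hmaps]
  refine Finset.sum_congr rfl fun j _ => ?_
  rw [Finset.mul_sum]
  refine Finset.sum_congr rfl fun Z hZ => ?_
  obtain ⟨h1, h2⟩ := Finset.mem_filter.mp hZ
  rw [← mul_assoc, key Z h1, h2, mul_assoc]
end

section
/- Let V be a finite set, φ : 2^V → {0,1} a Boolean function, and p_x ∈ [0,1] probability values for x ∈ V. Then the expected Shapley values satisfy the expected efficiency property: Σ_{x∈V} Escore_{c_Sh}(φ, x) = EV(φ) − φ(∅), where c_Sh is the Shapley coefficient function c_Sh(k,ℓ) = ℓ!·(k−ℓ−1)!/k!. -/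
open Finset

variable {α : Type*} [DecidableEq α]

/-- The Shapley coefficient function `c_Sh(k,ℓ) = ℓ!(k−ℓ−1)!/k!`. -/
def cShapley : ℕ × ℕ → ℚ :=
  fun kl => (Nat.factorial kl.2 * Nat.factorial (kl.1 - kl.2 - 1) : ℚ) / Nat.factorial kl.1

lemma aux_pos (k f : ℕ) (hf : 0 < f) (hk : f ≤ k) :
    (f : ℝ) * ((cShapley (k, f - 1) : ℚ) : ℝ) =
      (Nat.factorial f * Nat.factorial (k - f) : ℝ) / Nat.factorial k := by
  obtain ⟨m, rfl⟩ : ∃ m, f = m + 1 := ⟨f - 1, by omega⟩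
  have h : k - m - 1 = k - (m + 1) := by omega
  simp only [cShapley, Nat.add_sub_cancel, h, Nat.factorial_succ]
  push_cast
  ring

lemma aux_lt (k f : ℕ) (hk : f < k) :
    ((k - f : ℕ) : ℝ) * ((cShapley (k, f) : ℚ) : ℝ) =
      (Nat.factorial f * Nat.factorial (k - f) : ℝ) / Nat.factorial k := by
  obtain ⟨m, rfl⟩ : ∃ m, k = f + m + 1 := ⟨k - f - 1, by omega⟩
  have h : f + m + 1 - f = m + 1 := by omega
  simp only [cShapley, h, Nat.factorial_succ m, Nat.add_sub_cancel]
  push_cast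
  ring

lemma score_first (c : ℕ → ℝ) (φ : Finset α → ℝ) (Z : Finset α) :
    ∑ x ∈ Z, ∑ E ∈ (Z.erase x).powerset, c E.card * φ (insert x E) =
      ∑ F ∈ Z.powerset, (F.card : ℝ) * c (F.card - 1) * φ F := by
  have h1 : ∀ x ∈ Z, ∑ E ∈ (Z.erase x).powerset, c E.card * φ (insert x E) =
      ∑ F ∈ Z.powerset with x ∈ F, c (F.card - 1) * φ F := by
    intro x hx
    refine Finset.sum_bij' (fun E _ => insert x E) (fun F _ => F.erase x) ?_ ?_ ?_ ?_ ?_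
    · intro E hE
      simp only [mem_powerset, mem_filter] at hE ⊢
      exact ⟨insert_subset hx (hE.trans (erase_subset _ _)), mem_insert_self _ _⟩
    · intro F hF
      simp only [mem_powerset, mem_filter] at hF ⊢
      exact erase_subset_erase _ hF.1
    · intro E hE
      simp only [mem_powerset] at hE
      exact erase_insert (fun h => by simpa using hE h)
    · intro F hF
      simp only [mem_filter] at hF
      exact insert_erase hF.2
    · intro E hE
      simp only [mem_powerset] at hE
      rw [card_insert_of_notMem (fun h => by simpa using hE h), Nat.add_sub_cancel]
  rw [Finset.sum_congr rfl h1, Finset.sum_comm' (t' := Z.powerset) (s' := fun F => F)]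
  · refine Finset.sum_congr rfl fun F _ => ?_
    rw [sum_const, nsmul_eq_mul, mul_assoc]
  · intro x F
    simp only [mem_filter, mem_powerset]
    exact ⟨fun h => ⟨h.2.2, h.2.1⟩, fun h => ⟨h.2 h.1, h.2, h.1⟩⟩

lemma score_second (c : ℕ → ℝ) (φ : Finset α → ℝ) (Z : Finset α) :
    ∑ x ∈ Z, ∑ E ∈ (Z.erase x).powerset, c E.card * φ E =
      ∑ F ∈ Z.powerset, ((Z.card - F.card : ℕ) : ℝ) * c F.card * φ F := by
  rw [Finset.sum_comm' (t' := Z.powerset) (s' := fun F => Z \ F)]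
  · refine Finset.sum_congr rfl fun F hF => ?_
    rw [sum_const, nsmul_eq_mul, mul_assoc, card_sdiff_of_subset (mem_powerset.1 hF)]
  · intro x F
    simp only [mem_powerset, mem_sdiff, subset_erase]
    tauto

lemma efficiency (φ : Finset α → ℝ) (Z : Finset α) :
    ∑ x ∈ Z, score cShapley φ Z x = φ Z - φ ∅ := by
  have hk : (Nat.factorial Z.card : ℝ) ≠ 0 := by positivity
  simp only [score, mul_sub, sum_sub_distrib]
  rw [score_first (fun l => ((cShapley (Z.card, l) : ℚ) : ℝ)),
    score_second (fun l => ((cShapley (Z.card, l) : ℚ) : ℝ))]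
  set g : Finset α → ℝ := fun F =>
    (Nat.factorial F.card * Nat.factorial (Z.card - F.card) : ℝ) / Nat.factorial Z.card * φ F
    with hg
  have e1 : ∑ F ∈ Z.powerset, (F.card : ℝ) * ((cShapley (Z.card, F.card - 1) : ℚ) : ℝ) * φ F
      = ∑ F ∈ Z.powerset, (g F - if F = ∅ then φ ∅ else 0) := by
    refine Finset.sum_congr rfl fun F hF => ?_
    by_cases h : F = ∅
    · subst h
      simp [hg, hk]
    · rw [aux_pos _ _ (card_pos.2 (nonempty_iff_ne_empty.2 h)) (card_le_card (mem_powerset.1 hF))]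
      simp [hg, h]
  have e2 : ∑ F ∈ Z.powerset,
        ((Z.card - F.card : ℕ) : ℝ) * ((cShapley (Z.card, F.card) : ℚ) : ℝ) * φ F
      = ∑ F ∈ Z.powerset, (g F - if F = Z then φ Z else 0) := by
    refine Finset.sum_congr rfl fun F hF => ?_
    by_cases h : F = Z
    · subst h
      simp [hg, hk]
    · rw [aux_lt _ _ (card_lt_card ((mem_powerset.1 hF).ssubset_of_ne h))]
      simp [hg, h]
  rw [e1, e2, sum_sub_distrib, sum_sub_distrib, sum_ite_eq', sum_ite_eq']
  simp

lemma sum_PiP (p : α → ℝ) (V : Finset α) : ∑ Z ∈ V.powerset, PiP p V Z = 1 := by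
  have := Finset.prod_add p (fun x => 1 - p x) V
  simp only [PiP]
  rw [← this]
  simp

/-- Expected efficiency: the sum of expected Shapley values equals `EV(φ) − φ(∅)`. -/
theorem sum_escore_shapley_eq_ev_sub (p : α → ℝ) (V : Finset α) (φ : Finset α → ℝ)
    (hφ : ∀ E, φ E = 0 ∨ φ E = 1) (hp : ∀ x ∈ V, 0 ≤ p x ∧ p x ≤ 1) :
    ∑ x ∈ V, Escore cShapley p V φ x = EV p V φ - φ ∅ := by
  unfold Escore EV
  rw [Finset.sum_comm' (t' := V.powerset) (s' := fun Z => Z)]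
  · simp only [← mul_sum, efficiency, mul_sub, sum_sub_distrib]
    rw [← sum_mul, sum_PiP, one_mul]
  · intro x Z
    simp only [mem_filter, mem_powerset]
    exact ⟨fun h => ⟨h.2.2, h.2.1⟩, fun h => ⟨h.2 h.1, h.2, h.1⟩⟩
end

section
/- Let V be a finite set, φ : 2^V → {0,1} a Boolean function, x ∈ V, and p_y ∈ [0,1] probability values for y ∈ V. Then the expected Banzhaf value satisfies Escore_{c_Bz}(φ, x) = p_x · ( ENV(φ_{+x}) − ENV(φ_{−x}) ), where c_Bz is the Banzhaf coefficient function c_Bz(k,ℓ) = 1, and both ENV quantities are computed over V∖{x} with the probability values p_y for y ∈ V∖{x}. -/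
open Finset

variable {α : Type*} [DecidableEq α]

/-- The expected Banzhaf value in terms of expected nested values
(Equation (4) of the paper). -/
theorem escore_banzhaf_eq (p : α → ℝ) (V : Finset α) (φ : Finset α → ℝ)
    (hφ : ∀ E, φ E = 0 ∨ φ E = 1) (x : α) (hx : x ∈ V)
    (hp : ∀ y ∈ V, 0 ≤ p y ∧ p y ≤ 1) :
    Escore (fun _ => (1 : ℚ)) p V φ x =
      p x * (ENV p (V.erase x) (fun E => φ (insert x E)) - ENV p (V.erase x) φ) := by
  unfold Escore ENV
  rw [← Finset.sum_sub_distrib, Finset.mul_sum]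
  refine Finset.sum_bij' (fun Z _ => Z.erase x) (fun Z _ => insert x Z) ?_ ?_ ?_ ?_ ?_
  · intro Z hZ
    simp only [mem_filter, mem_powerset] at hZ ⊢
    exact erase_subset_erase x hZ.1
  · intro Z hZ
    simp only [mem_filter, mem_powerset] at hZ ⊢
    exact ⟨insert_subset hx (hZ.trans (erase_subset _ _)), mem_insert_self _ _⟩
  · intro Z hZ
    exact insert_erase (mem_filter.1 hZ).2
  · intro Z hZ
    exact erase_insert (fun h => (mem_erase.1 (mem_powerset.1 hZ h)).1 rfl)
  · intro Z hZ
    have hxZ := (mem_filter.1 hZ).2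
    have h1 : V.erase x \ Z.erase x = V \ Z := by
      ext y
      simp only [mem_sdiff, mem_erase]
      grind
    have h2 : PiP p V Z = p x * PiP p (V.erase x) (Z.erase x) := by
      unfold PiP
      rw [h1, ← mul_prod_erase Z p hxZ, mul_assoc]
    rw [h2]
    simp only [score, Rat.cast_one, one_mul, sum_sub_distrib]
    ring
end

section
/- Let V be a finite set with n elements, φ : 2^V → {0,1} a Boolean function, and p_x probability values with 0 ≤ p_x < 1 for all x ∈ V. Let M = max_{x∈V} p_x (with M = 0 if V is empty), let z be a rational number with 0 < z < 1 − M, set p^z_x = z·p_x/(1−p_x) for each x ∈ V, and let C = ∏_{x∈V} (1 − p_x). Then each p^z_x lies in [0,1], and letting ENV^z(φ) denote the expected nested value of φ computed with the probabilities p^z_x, we have C · ENV^z(φ) = Σ_{j=0}^{n} z^j · EV_j(φ), where EV_j(φ) is the expected value of fixed size j computed with the original probabilities p_x. -/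
open Finset

variable {α : Type*} [DecidableEq α]

theorem sum_PiP_superset (q : α → ℝ) (V E : Finset α) (hE : E ⊆ V) :
    ∑ Z ∈ V.powerset, (if E ⊆ Z then PiP q V Z else 0) = ∏ x ∈ E, q x := by
  have h := Finset.prod_add q (fun i => if i ∈ E then 0 else 1 - q i) V
  have h2 : ∏ i ∈ V, (q i + if i ∈ E then 0 else 1 - q i) = ∏ x ∈ E, q x := by
    rw [← Finset.prod_subset hE (f := fun i => q i + if i ∈ E then 0 else 1 - q i)]
    · exact Finset.prod_congr rfl (fun x hx => by simp [hx])
    · intro x _ hx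
      simp [hx]
  rw [← h2, h]
  refine Finset.sum_congr rfl (fun Z hZ => ?_)
  split_ifs with hEZ
  · unfold PiP
    congr 1
    refine Finset.prod_congr rfl (fun x hx => ?_)
    rw [if_neg (fun hxE => (Finset.mem_sdiff.1 hx).2 (hEZ hxE))]
  · obtain ⟨x, hxE, hxZ⟩ := Finset.not_subset.1 hEZ
    rw [Finset.prod_eq_zero (i := x) (Finset.mem_sdiff.2 ⟨hE hxE, hxZ⟩) (by simp [hxE]), mul_zero]

theorem ENV_eq (q : α → ℝ) (V : Finset α) (φ : Finset α → ℝ) :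
    ENV q V φ = ∑ E ∈ V.powerset, (∏ x ∈ E, q x) * φ E := by
  have h : ∀ Z ∈ V.powerset, PiP q V Z * ∑ E ∈ Z.powerset, φ E
      = ∑ E ∈ V.powerset, (if E ⊆ Z then PiP q V Z else 0) * φ E := by
    intro Z hZ
    rw [Finset.mul_sum]
    have hs : Z.powerset ⊆ V.powerset := Finset.powerset_mono.2 (Finset.mem_powerset.1 hZ)
    rw [← Finset.sum_subset hs]
    · refine Finset.sum_congr rfl (fun E hE => ?_)
      rw [if_pos (Finset.mem_powerset.1 hE)]
    · intro E _ hE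
      rw [if_neg (fun h => hE (Finset.mem_powerset.2 h)), zero_mul]
  unfold ENV
  rw [Finset.sum_congr rfl h, Finset.sum_comm]
  refine Finset.sum_congr rfl (fun E hE => ?_)
  rw [← Finset.sum_mul, sum_PiP_superset q V E (Finset.mem_powerset.1 hE)]

/-- Polynomial interpolation identity reducing expected values of fixed size to
expected nested values. -/
theorem env_modified_prob_eq_sum_evk (p : α → ℝ) (V : Finset α) (n : ℕ)
    (hV : V.card = n) (φ : Finset α → ℝ) (hφ : ∀ E, φ E = 0 ∨ φ E = 1)
    (hp : ∀ x ∈ V, 0 ≤ p x ∧ p x < 1) (z : ℝ) (hz0 : 0 < z) (hz1 : z < 1)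
    (hzM : ∀ x ∈ V, z < 1 - p x) :
    (∀ x ∈ V, 0 ≤ z * p x / (1 - p x) ∧ z * p x / (1 - p x) ≤ 1) ∧
    (∏ x ∈ V, (1 - p x)) * ENV (fun x => z * p x / (1 - p x)) V φ =
      ∑ j ∈ Finset.range (n + 1), z ^ j * EVk p V φ j := by
  constructor
  · intro x hx
    obtain ⟨h0, h1⟩ := hp x hx
    have hM := hzM x hx
    have hpos : 0 < 1 - p x := by linarith
    refine ⟨by positivity, ?_⟩
    rw [div_le_one hpos]
    nlinarith
  · have hR : ∑ j ∈ Finset.range (n + 1), z ^ j * EVk p V φ j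
        = ∑ E ∈ V.powerset, z ^ E.card * (PiP p V E * φ E) := by
      rw [← Finset.sum_fiberwise_of_maps_to (s := V.powerset) (t := Finset.range (n + 1))
        (g := Finset.card)]
      · refine Finset.sum_congr rfl (fun j _ => ?_)
        unfold EVk
        rw [Finset.mul_sum]
        refine Finset.sum_congr rfl (fun E hE => ?_)
        rw [(Finset.mem_filter.1 hE).2]
      · intro E hE
        have := Finset.card_le_card (Finset.mem_powerset.1 hE)
        exact Finset.mem_range.2 (by omega)
    rw [hR, ENV_eq, Finset.mul_sum]
    refine Finset.sum_congr rfl (fun E hE => ?_)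
    have hEV := Finset.mem_powerset.1 hE
    have key : (∏ x ∈ E, (1 - p x)) * ∏ x ∈ E, (z * p x / (1 - p x))
        = z ^ E.card * ∏ x ∈ E, p x := by
      rw [← Finset.prod_mul_distrib, ← Finset.prod_const, ← Finset.prod_mul_distrib]
      refine Finset.prod_congr rfl (fun x hx => ?_)
      have : 1 - p x ≠ 0 := by linarith [(hp x (hEV hx)).2]
      field_simp
    rw [← Finset.prod_sdiff hEV]
    unfold PiP
    linear_combination (∏ x ∈ V \ E, (1 - p x)) * φ E * key
end

section
/- Let V be a finite set, φ : 2^V → {0,1} a Boolean function, p_y ∈ [0,1] probability values for y ∈ V, and let x ∉ V be a fresh variable with p_x = 1. Define the Boolean function φ' on V' = V ∪ {x} by φ'(E) = φ(E∖{x}) · [x ∈ E] (i.e., φ' = φ ∧ x). Then Escore_{c_Bz}(φ', x), computed over V' with these probabilities, equals ENV(φ) computed over V with the values p_y. -/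
open Finset

variable {α : Type*} [DecidableEq α]

/-- The expected Banzhaf value of a fresh variable `x` (with probability 1) in `φ ∧ x`
equals the expected nested value of `φ`. -/
theorem escore_banzhaf_conj_fresh (p : α → ℝ) (V : Finset α) (φ : Finset α → ℝ)
    (hφ : ∀ E, φ E = 0 ∨ φ E = 1) (x : α) (hx : x ∉ V) (hpx : p x = 1)
    (hp : ∀ y ∈ V, 0 ≤ p y ∧ p y ≤ 1) :
    Escore (fun _ => (1 : ℚ)) p (insert x V)
        (fun E => if x ∈ E then φ (E.erase x) else 0) x =
      ENV p V φ := by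
  unfold Escore ENV
  symm
  refine Finset.sum_bij' (fun Z _ => insert x Z) (fun Z _ => Z.erase x) ?_ ?_ ?_ ?_ ?_
  · intro Z hZ
    rw [Finset.mem_powerset] at hZ
    simp only [Finset.mem_filter, Finset.mem_powerset]
    exact ⟨Finset.insert_subset_insert x hZ, Finset.mem_insert_self x Z⟩
  · intro Z hZ
    simp only [Finset.mem_filter, Finset.mem_powerset] at hZ
    rw [Finset.mem_powerset]
    exact Finset.subset_insert_iff.mp hZ.1
  · intro Z hZ
    rw [Finset.mem_powerset] at hZ
    exact Finset.erase_insert (fun h => hx (hZ h))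
  · intro Z hZ
    simp only [Finset.mem_filter] at hZ
    exact Finset.insert_erase hZ.2
  · intro Z hZ
    rw [Finset.mem_powerset] at hZ
    have hxZ : x ∉ Z := fun h => hx (hZ h)
    have hd : insert x V \ insert x Z = V \ Z := by
      ext y
      simp only [Finset.mem_sdiff, Finset.mem_insert]
      constructor
      · tauto
      · rintro ⟨h1, h2⟩
        refine ⟨Or.inr h1, ?_⟩
        rintro (rfl | h)
        · exact hx h1
        · exact h2 h
    unfold PiP score
    rw [hd, Finset.prod_insert hxZ, hpx, one_mul, Finset.erase_insert hxZ]
    congr 1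
    refine Finset.sum_congr rfl ?_
    intro E hE
    rw [Finset.mem_powerset] at hE
    have hxE : x ∉ E := fun h => hxZ (hE h)
    simp [hxE]
end

section
/- Let V be a finite set, φ : 2^V → {0,1} a Boolean function, p_y ∈ [0,1] probability values for y ∈ V, and let x ∉ V be a fresh variable with p_x = 1. Define the Boolean function φ' on V' = V ∪ {x} by φ'(E) = 1 if x ∈ E or φ(E∖{x}) = 1, and φ'(E) = 0 otherwise (i.e., φ' = φ ∨ x). Then Escore_{c_Bz}(φ', x), computed over V' with these probabilities, equals ∏_{y∈V}(1 + p_y) − ENV(φ), where ENV(φ) is computed over V with the values p_y. -/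
open Finset

variable {α : Type*} [DecidableEq α]

theorem escore_aux (p : α → ℝ) (V : Finset α) (φ ψ : Finset α → ℝ) (x : α) (hx : x ∉ V)
    (hpx : p x = 1) (h1 : ∀ E, ψ (insert x E) = 1) (h2 : ∀ E, x ∉ E → ψ E = φ E) :
    Escore (fun _ => (1 : ℚ)) p (insert x V) ψ x = (∏ y ∈ V, (1 + p y)) - ENV p V φ := by
  have hprod : (∏ y ∈ V, (1 + p y)) = ∑ Z ∈ V.powerset, PiP p V Z * (2 : ℝ) ^ Z.card := by
    have : (∏ y ∈ V, (1 + p y)) = ∏ y ∈ V, (2 * p y + (1 - p y)) :=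
      Finset.prod_congr rfl fun y _ => by ring
    rw [this, Finset.prod_add]
    refine Finset.sum_congr rfl fun Z _ => ?_
    rw [PiP, Finset.prod_mul_distrib, Finset.prod_const]
    ring
  rw [hprod, ENV, ← Finset.sum_sub_distrib, Escore, Finset.sum_filter,
    Finset.sum_powerset_insert hx]
  have h0 : ∑ Z ∈ V.powerset, (if x ∈ Z then
      PiP p (insert x V) Z * score (fun _ => (1 : ℚ)) ψ Z x else 0) = 0 := by
    refine Finset.sum_eq_zero fun Z hZ => if_neg fun h => hx (Finset.mem_powerset.1 hZ h)
  rw [h0, zero_add]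
  refine Finset.sum_congr rfl fun Z hZ => ?_
  have hxZ : x ∉ Z := fun h => hx (Finset.mem_powerset.1 hZ h)
  rw [if_pos (Finset.mem_insert_self x Z)]
  have hP : PiP p (insert x V) (insert x Z) = PiP p V Z := by
    rw [PiP, PiP, Finset.prod_insert hxZ, hpx, one_mul, Finset.insert_sdiff_insert,
      Finset.sdiff_insert_of_notMem hx]
  have hS : score (fun _ => (1 : ℚ)) ψ (insert x Z) x
      = (2 : ℝ) ^ Z.card - ∑ E ∈ Z.powerset, φ E := by
    rw [score, Finset.erase_insert hxZ]
    have : ∑ E ∈ Z.powerset, (((1 : ℚ) : ℝ)) * (ψ (insert x E) - ψ E)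
        = ∑ E ∈ Z.powerset, (1 - φ E) := by
      refine Finset.sum_congr rfl fun E hE => ?_
      rw [h1, h2 E fun h => hxZ (Finset.mem_powerset.1 hE h)]
      simp
    rw [this, Finset.sum_sub_distrib]
    simp [Finset.card_powerset]
  rw [hP, hS, mul_sub]

attribute [local instance] Classical.propDecidable

/-- The expected Banzhaf value of a fresh variable `x` (with probability 1) in `φ ∨ x`
equals `Π_{y∈V}(1+p_y) − ENV(φ)`. -/
theorem escore_banzhaf_disj_fresh (p : α → ℝ) (V : Finset α) (φ : Finset α → ℝ)
    (hφ : ∀ E, φ E = 0 ∨ φ E = 1) (x : α) (hx : x ∉ V) (hpx : p x = 1)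
    (hp : ∀ y ∈ V, 0 ≤ p y ∧ p y ≤ 1) :
    Escore (fun _ => (1 : ℚ)) p (insert x V)
        (fun E => if x ∈ E ∨ φ (E.erase x) = 1 then 1 else 0) x =
      (∏ y ∈ V, (1 + p y)) - ENV p V φ := by
  apply escore_aux p V φ _ x hx hpx
  · intro E
    simp
  · intro E hE
    rcases hφ E with h | h <;> simp [hE, h]
end

section
/- Let V₁ and V₂ be disjoint finite sets with probability values p_x ∈ [0,1] for x ∈ V₁ ∪ V₂, let φ₁ : 2^{V₁} → {0,1} and φ₂ : 2^{V₂} → {0,1} be Boolean functions, and let φ be the Boolean function on V₁ ∪ V₂ defined by φ(E) = φ₁(E ∩ V₁) · φ₂(E ∩ V₂). Then for all k, ℓ ∈ ℕ, ENV_{k,ℓ}(φ) = Σ_{k₁=0}^{k} Σ_{ℓ₁=0}^{min(k₁,ℓ)} ENV_{k₁,ℓ₁}(φ₁) · ENV_{k−k₁, ℓ−ℓ₁}(φ₂), where ENV quantities of φ₁ and φ₂ are computed over V₁ and V₂ respectively. -/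
open Finset

variable {α : Type*} [DecidableEq α]

theorem aux_split (V₁ V₂ : Finset α) (hd : Disjoint V₁ V₂) (F : Finset α → ℝ) (k : ℕ) :
    ∑ Z ∈ (V₁ ∪ V₂).powerset.filter (fun Z => Z.card = k), F Z =
      ∑ i ∈ Finset.range (k + 1), ∑ A ∈ V₁.powerset.filter (fun Z => Z.card = i),
        ∑ B ∈ V₂.powerset.filter (fun Z => Z.card = k - i), F (A ∪ B) := by
  rw [← Finset.sum_fiberwise_of_maps_to (t := Finset.range (k + 1))
    (g := fun Z => (Z ∩ V₁).card)]
  · refine Finset.sum_congr rfl fun i hi => ?_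
    rw [← Finset.sum_product']
    have hi' : i ≤ k := by simpa [Nat.lt_succ_iff] using hi
    have key : ∀ Z : Finset α, Z ⊆ V₁ ∪ V₂ → Z ∩ V₁ ∪ Z ∩ V₂ = Z := by
      intro Z hZ
      rw [← Finset.inter_union_distrib_left, Finset.inter_eq_left.2 hZ]
    have hk1 : ∀ A B : Finset α, A ⊆ V₁ → B ⊆ V₂ → (A ∪ B) ∩ V₁ = A := by
      intro A B hA hB
      rw [Finset.union_inter_distrib_right, Finset.inter_eq_left.2 hA,
        Finset.disjoint_iff_inter_eq_empty.1 (hd.symm.mono_left hB), Finset.union_empty]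
    have hk2 : ∀ A B : Finset α, A ⊆ V₁ → B ⊆ V₂ → (A ∪ B) ∩ V₂ = B := by
      intro A B hA hB
      rw [Finset.union_inter_distrib_right, Finset.inter_eq_left.2 hB,
        Finset.disjoint_iff_inter_eq_empty.1 (hd.mono_left hA), Finset.empty_union]
    refine Finset.sum_bij' (fun Z _ => (Z ∩ V₁, Z ∩ V₂)) (fun q _ => q.1 ∪ q.2) ?_ ?_ ?_ ?_ ?_
    · intro Z hZ
      simp only [Finset.mem_filter, Finset.mem_powerset, Finset.mem_product] at hZ ⊢
      obtain ⟨⟨h1, h2⟩, h3⟩ := hZ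
      refine ⟨⟨Finset.inter_subset_right, h3⟩, Finset.inter_subset_right, ?_⟩
      have := Finset.card_union_of_disjoint (s := Z ∩ V₁) (t := Z ∩ V₂)
        (hd.mono Finset.inter_subset_right Finset.inter_subset_right)
      rw [key Z h1] at this
      omega
    · rintro ⟨A, B⟩ hq
      simp only [Finset.mem_filter, Finset.mem_powerset, Finset.mem_product] at hq ⊢
      obtain ⟨⟨h1, h2⟩, h3, h4⟩ := hq
      refine ⟨⟨Finset.union_subset_union h1 h3, ?_⟩, ?_⟩
      · rw [Finset.card_union_of_disjoint (hd.mono h1 h3)]; omega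
      · rw [hk1 A B h1 h3, h2]
    · intro Z hZ
      simp only [Finset.mem_filter, Finset.mem_powerset] at hZ
      exact key Z hZ.1.1
    · rintro ⟨A, B⟩ hq
      simp only [Finset.mem_filter, Finset.mem_powerset, Finset.mem_product] at hq
      simp only [hk1 A B hq.1.1 hq.2.1, hk2 A B hq.1.1 hq.2.1]
    · intro Z hZ
      simp only [Finset.mem_filter, Finset.mem_powerset] at hZ
      simp only [key Z hZ.1.1]
  · intro Z hZ
    simp only [Finset.mem_filter, Finset.mem_powerset] at hZ
    have := Finset.card_le_card (Finset.inter_subset_left : Z ∩ V₁ ⊆ Z)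
    simp only [Finset.mem_range]
    omega

theorem aux_PiP (p : α → ℝ) (V₁ V₂ A B : Finset α) (hd : Disjoint V₁ V₂)
    (hA : A ⊆ V₁) (hB : B ⊆ V₂) :
    PiP p (V₁ ∪ V₂) (A ∪ B) = PiP p V₁ A * PiP p V₂ B := by
  unfold PiP
  have h : (V₁ ∪ V₂) \ (A ∪ B) = (V₁ \ A) ∪ (V₂ \ B) := by
    have h1 : ∀ x, x ∈ V₁ → x ∉ V₂ := fun x hx => Finset.disjoint_left.1 hd hx
    ext x
    have h2 := @hA x
    have h3 := @hB x
    have h4 := h1 x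
    simp only [Finset.mem_sdiff, Finset.mem_union]
    tauto
  rw [h, Finset.prod_union (hd.mono hA hB),
    Finset.prod_union (hd.mono Finset.sdiff_subset Finset.sdiff_subset)]
  ring

theorem aux_zero (p : α → ℝ) (V : Finset α) (φ : Finset α → ℝ) (k l : ℕ) (h : k < l) :
    ENVkl p V φ k l = 0 := by
  unfold ENVkl
  refine Finset.sum_eq_zero fun Z hZ => ?_
  simp only [Finset.mem_filter] at hZ
  rw [Finset.filter_eq_empty_iff.2, Finset.sum_empty, mul_zero]
  intro E hE hc
  have := Finset.card_le_card (Finset.mem_powerset.1 hE)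
  omega

/-- `ENV_{k,ℓ}` of a decomposable conjunction satisfies a convolution identity. -/
theorem envkl_conj_disjoint (p : α → ℝ) (V₁ V₂ : Finset α) (hd : Disjoint V₁ V₂)
    (hp : ∀ x ∈ V₁ ∪ V₂, 0 ≤ p x ∧ p x ≤ 1)
    (φ₁ φ₂ : Finset α → ℝ) (hφ₁ : ∀ E, φ₁ E = 0 ∨ φ₁ E = 1)
    (hφ₂ : ∀ E, φ₂ E = 0 ∨ φ₂ E = 1) (k ℓ : ℕ) :
    ENVkl p (V₁ ∪ V₂) (fun E => φ₁ (E ∩ V₁) * φ₂ (E ∩ V₂)) k ℓ =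
      ∑ k₁ ∈ Finset.range (k + 1), ∑ ℓ₁ ∈ Finset.range (min k₁ ℓ + 1),
        ENVkl p V₁ φ₁ k₁ ℓ₁ * ENVkl p V₂ φ₂ (k - k₁) (ℓ - ℓ₁) := by
  have hr : ∀ k₁, ∑ ℓ₁ ∈ Finset.range (min k₁ ℓ + 1),
        ENVkl p V₁ φ₁ k₁ ℓ₁ * ENVkl p V₂ φ₂ (k - k₁) (ℓ - ℓ₁) =
      ∑ ℓ₁ ∈ Finset.range (ℓ + 1),
        ENVkl p V₁ φ₁ k₁ ℓ₁ * ENVkl p V₂ φ₂ (k - k₁) (ℓ - ℓ₁) := by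
    intro k₁
    refine Finset.sum_subset (fun x hx => ?_) (fun x hx hx' => ?_)
    · simp only [Finset.mem_range] at hx ⊢; omega
    · simp only [Finset.mem_range] at hx hx'
      rw [aux_zero _ _ _ _ _ (by omega), zero_mul]
  simp only [hr]
  unfold ENVkl
  rw [aux_split V₁ V₂ hd]
  refine Finset.sum_congr rfl fun i _ => ?_
  simp only [Finset.sum_mul_sum]
  refine Eq.trans ?_ Finset.sum_comm
  refine Finset.sum_congr rfl fun A hA => ?_
  refine Eq.trans ?_ Finset.sum_comm
  refine Finset.sum_congr rfl fun B hB => ?_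
  simp only [Finset.mem_filter, Finset.mem_powerset] at hA hB
  rw [aux_split A B (hd.mono hA.1 hB.1), aux_PiP p V₁ V₂ A B hd hA.1 hB.1, Finset.mul_sum]
  refine Finset.sum_congr rfl fun j _ => ?_
  rw [mul_mul_mul_comm, Finset.sum_mul_sum]
  congr 1
  refine Finset.sum_congr rfl fun E hE => Finset.sum_congr rfl fun E' hE' => ?_
  simp only [Finset.mem_filter, Finset.mem_powerset] at hE hE'
  have e1 := hE.1.trans hA.1
  have e2 := hE'.1.trans hB.1
  rw [Finset.union_inter_distrib_right, Finset.union_inter_distrib_right,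
    Finset.inter_eq_left.2 e1, Finset.inter_eq_left.2 e2,
    Finset.disjoint_iff_inter_eq_empty.1 (hd.symm.mono_left e2),
    Finset.disjoint_iff_inter_eq_empty.1 (hd.mono_left e1),
    Finset.union_empty, Finset.empty_union]
end

section
/- Let V be a finite set with n elements, c : ℕ×ℕ → ℚ a coefficient function, φ : 2^V → {0,1} a Boolean function, x ∈ V, and suppose all probability values are equal: p_y = p ∈ [0,1] for all y ∈ V. For ℓ ∈ ℕ let #SAT_ℓ(φ_{+x}) (resp. #SAT_ℓ(φ_{−x})) denote the number of subsets E ⊆ V∖{x} with |E| = ℓ such that φ(E∪{x}) = 1 (resp. φ(E) = 1). Then Escore_c(φ, x) = Σ_{ℓ=0}^{n−1} ( #SAT_ℓ(φ_{+x}) − #SAT_ℓ(φ_{−x}) ) · Σ_{k=ℓ}^{n−1} C(n−1−ℓ, k−ℓ) · c(k+1, ℓ) · p^{k+1} · (1−p)^{n−k−1}, where C(·,·) denotes the binomial coefficient. -/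
open Finset

variable {α : Type*} [DecidableEq α]

theorem aux_inner (U E : Finset α) (hE : E ⊆ U) (g : ℕ → ℝ) :
    ∑ Y ∈ U.powerset.filter (fun Y => E ⊆ Y), g Y.card =
      ∑ k ∈ Finset.Icc E.card U.card, ((U.card - E.card).choose (k - E.card) : ℝ) * g k := by
  have h1 : ∑ Y ∈ U.powerset.filter (fun Y => E ⊆ Y), g Y.card =
      ∑ T ∈ (U \ E).powerset, g (E.card + T.card) := by
    refine Finset.sum_bij' (fun Y _ => Y \ E) (fun T _ => E ∪ T) ?_ ?_ ?_ ?_ ?_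
    · intro Y hY
      simp only [mem_filter, mem_powerset] at hY ⊢
      exact sdiff_subset_sdiff hY.1 (le_refl _)
    · intro T hT
      simp only [mem_filter, mem_powerset] at hT ⊢
      exact ⟨union_subset hE (hT.trans sdiff_subset), subset_union_left⟩
    · intro Y hY
      simp only [mem_filter, mem_powerset] at hY
      exact union_sdiff_of_subset hY.2
    · intro T hT
      simp only [mem_powerset] at hT
      ext a
      have := @hT a
      simp only [mem_sdiff, mem_union] at this ⊢
      tauto
    · intro Y hY
      simp only [mem_filter, mem_powerset] at hY
      have := card_sdiff_add_card_eq_card hY.2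
      congr 1
      omega
  have hc : (U \ E).card = U.card - E.card := card_sdiff_of_subset hE
  have hle := card_le_card hE
  rw [h1, Finset.sum_powerset_apply_card (fun j => g (E.card + j)), hc,
    ← Finset.Ico_add_one_right_eq_Icc, Finset.sum_Ico_eq_sum_range,
    show U.card + 1 - E.card = U.card - E.card + 1 by omega]
  simp

theorem aux_reindex (V : Finset α) (x : α) (hx : x ∈ V) (F : Finset α → ℝ) :
    ∑ Z ∈ V.powerset.filter (fun Z => x ∈ Z), F Z =
      ∑ Y ∈ (V.erase x).powerset, F (insert x Y) := by
  refine Finset.sum_bij' (fun Z _ => Z.erase x) (fun Y _ => insert x Y) ?_ ?_ ?_ ?_ ?_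
  · intro Z hZ
    simp only [mem_filter, mem_powerset] at hZ ⊢
    exact erase_subset_erase x hZ.1
  · intro Y hY
    simp only [mem_filter, mem_powerset] at hY ⊢
    exact ⟨insert_subset hx (hY.trans (erase_subset _ _)), mem_insert_self _ _⟩
  · intro Z hZ
    simp only [mem_filter, mem_powerset] at hZ
    exact insert_erase hZ.2
  · intro Y hY
    simp only [mem_powerset] at hY
    exact erase_insert (fun h => notMem_erase x V (hY h))
  · intro Z hZ
    simp only [mem_filter, mem_powerset] at hZ
    rw [insert_erase hZ.2]

attribute [local instance] Classical.propDecidable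

/-- Expected score when all probabilities are equal, in terms of the numbers of
satisfying assignments of each size. -/
theorem escore_const_prob (c : ℕ × ℕ → ℚ) (V : Finset α) (n : ℕ) (hV : V.card = n)
    (φ : Finset α → ℝ) (hφ : ∀ E, φ E = 0 ∨ φ E = 1) (x : α) (hx : x ∈ V)
    (p : ℝ) (hp : 0 ≤ p ∧ p ≤ 1) :
    Escore c (fun _ => p) V φ x =
      ∑ ℓ ∈ Finset.range n,
        ((((V.erase x).powerset.filter
              (fun E => E.card = ℓ ∧ φ (insert x E) = 1)).card : ℝ)
          - (((V.erase x).powerset.filter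
              (fun E => E.card = ℓ ∧ φ E = 1)).card : ℝ)) *
        ∑ k ∈ Finset.Icc ℓ (n - 1),
          (Nat.choose (n - 1 - ℓ) (k - ℓ) : ℝ) * (c (k + 1, ℓ) : ℝ)
            * p ^ (k + 1) * (1 - p) ^ (n - k - 1) := by
  classical
  have hU : (V.erase x).card = n - 1 := by rw [card_erase_of_mem hx, hV]
  have hn : 0 < n := hV ▸ card_pos.mpr ⟨x, hx⟩
  set U := V.erase x with hUdef
  have hxU : ∀ Y ⊆ U, x ∉ Y := fun Y hY h => notMem_erase x V (hY h)
  set g : ℕ → ℕ → ℝ := fun ℓ k => (c (k + 1, ℓ) : ℝ) * p ^ (k + 1) * (1 - p) ^ (n - k - 1)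
    with hg
  set G : ℕ → ℝ := fun ℓ => ∑ k ∈ Finset.Icc ℓ (n - 1),
          (Nat.choose (n - 1 - ℓ) (k - ℓ) : ℝ) * (c (k + 1, ℓ) : ℝ)
            * p ^ (k + 1) * (1 - p) ^ (n - k - 1) with hG
  have h1 : Escore c (fun _ => p) V φ x =
      ∑ Y ∈ U.powerset, ∑ E ∈ Y.powerset, (φ (insert x E) - φ E) * g E.card Y.card := by
    unfold Escore
    rw [aux_reindex V x hx]
    refine Finset.sum_congr rfl fun Y hY => ?_
    have hY' := mem_powerset.mp hY
    have hxY := hxU Y hY'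
    have hsub : insert x Y ⊆ V := insert_subset hx (hY'.trans (erase_subset _ _))
    unfold PiP score
    rw [erase_insert hxY, prod_const, prod_const, card_sdiff_of_subset hsub,
      card_insert_of_notMem hxY, hV, Finset.mul_sum]
    refine Finset.sum_congr rfl fun E _ => ?_
    simp only [hg, Nat.sub_sub]
    ring
  have h2 : Escore c (fun _ => p) V φ x =
      ∑ E ∈ U.powerset, (φ (insert x E) - φ E) * G E.card := by
    rw [h1, Finset.sum_comm' (t' := U.powerset)
      (s' := fun E => U.powerset.filter (fun Y => E ⊆ Y))]
    · refine Finset.sum_congr rfl fun E hE => ?_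
      rw [← Finset.mul_sum, aux_inner U E (mem_powerset.mp hE) (g E.card), hU]
      congr 1
      refine Finset.sum_congr rfl fun k _ => ?_
      simp only [hg]
      ring
    · intro Y E
      simp only [mem_filter, mem_powerset]
      constructor
      · rintro ⟨a, b⟩
        exact ⟨⟨a, b⟩, b.trans a⟩
      · rintro ⟨⟨a, b⟩, _⟩
        exact ⟨a, b⟩
  have hcount : ∀ (ψ : Finset α → ℝ), (∀ E, ψ E = 0 ∨ ψ E = 1) → ∀ ℓ : ℕ,
      ((U.powerset.filter (fun E => E.card = ℓ ∧ ψ E = 1)).card : ℝ) =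
        ∑ E ∈ U.powerset.filter (fun E => E.card = ℓ), ψ E := by
    intro ψ hψ ℓ
    rw [← Finset.filter_filter, Finset.card_filter]
    push_cast
    refine Finset.sum_congr rfl fun E _ => ?_
    rcases hψ E with h | h <;> simp [h]
  rw [h2, ← Finset.sum_fiberwise_of_maps_to (t := Finset.range n) (g := Finset.card)]
  · refine Finset.sum_congr rfl fun ℓ _ => ?_
    have e1 := hcount (fun E => φ (insert x E)) (fun E => hφ _) ℓ
    have e2 := hcount φ hφ ℓ
    have e3 : ∑ E ∈ U.powerset.filter (fun E => E.card = ℓ),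
        (φ (insert x E) - φ E) * G E.card =
        (∑ E ∈ U.powerset.filter (fun E => E.card = ℓ), φ (insert x E) -
        ∑ E ∈ U.powerset.filter (fun E => E.card = ℓ), φ E) * G ℓ := by
      rw [← Finset.sum_sub_distrib, Finset.sum_mul]
      refine Finset.sum_congr rfl fun E hE => ?_
      rw [(mem_filter.mp hE).2]
    rw [← e1, ← e2] at e3
    convert e3 using 1
  · intro E hE
    have := card_le_card (mem_powerset.mp hE)
    simp only [mem_range]
    omega
end
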